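/- Quadratic identity for the Nijenhuis tensor in Type IIA geometry (pointwise form): let N be a φ₀-compatible Nijenhuis-type tensor on ℝ⁶. Then (N²₋)_{ij} = 2(N²₊)_{ij} − (1/4)|N|²·δ_{ij} for all i, j ∈ {1,…,6}. In particular, the symmetric matrix (N²₊) satisfies 0 ≤ (N²₊) ≤ (1/4)|N|²·Id as quadratic forms. -/

import Mathlib

noncomputable section

/-- The underlying vector space `ℝ⁶`. -/
abbrev V6 : Type := Fin 6 → ℝ

/-- The standard basis of `ℝ⁶`. -/
def e6 (i : Fin 6) : V6 := fun j => if j = i then (1 : ℝ) else 0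

/-- The standard complex structure `J` with `Je₁=e₂, Je₂=−e₁, Je₃=e₄, Je₄=−e₃, Je₅=e₆,
Je₆=−e₅`. -/
def Jstd (x : V6) : V6 := ![-x 1, x 0, -x 3, x 2, -x 5, x 4]

/-- For a trilinear map `T` antisymmetric in its last two arguments and a 3-form `μ`,
the quadrilinear map `T ⊠ μ` (indices raised with the standard Euclidean metric). -/
def boxt (T μ : V6 → V6 → V6 → ℝ) (x y z w : V6) : ℝ :=
  ∑ p : Fin 6,
    (T (e6 p) x y * μ (e6 p) z w + T (e6 p) z w * μ (e6 p) x y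
      - T (e6 p) x z * μ (e6 p) y w - T (e6 p) y w * μ (e6 p) x z
      + T (e6 p) x w * μ (e6 p) y z + T (e6 p) y z * μ (e6 p) x w)

/-- A 3-form, viewed as a trilinear function of vectors. -/
def ap3 (φ : AlternatingMap ℝ V6 ℝ (Fin 3)) : V6 → V6 → V6 → ℝ :=
  fun x y z => φ ![x, y, z]

/-- The elementary 3-form `e^a ∧ e^b ∧ e^c`, as a trilinear function. -/
def elem3 (a b c : Fin 6) (x y z : V6) : ℝ :=
  Matrix.det !![x a, x b, x c; y a, y b, y c; z a, z b, z c]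

/-- The model 3-form `φ₀ = e¹∧e³∧e⁵ − e¹∧e⁴∧e⁶ − e²∧e⁴∧e⁵ − e²∧e³∧e⁶`. -/
def phi0 (x y z : V6) : ℝ :=
  elem3 0 2 4 x y z - elem3 0 3 5 x y z - elem3 1 3 4 x y z - elem3 1 2 5 x y z

/-- Components `N_{ijk} = N(e_i, e_j, e_k)`. -/
def Nc (N : V6 →ₗ[ℝ] V6 →ₗ[ℝ] V6 →ₗ[ℝ] ℝ) (i j k : Fin 6) : ℝ := N (e6 i) (e6 j) (e6 k)

/-- `(N²₊)_{ij} = Σ_{p,k} N_{pki} N_{pkj}`. -/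
def N2p (N : V6 →ₗ[ℝ] V6 →ₗ[ℝ] V6 →ₗ[ℝ] ℝ) (i j : Fin 6) : ℝ :=
  ∑ p : Fin 6, ∑ k : Fin 6, Nc N p k i * Nc N p k j

/-- `(N²₋)_{ij} = Σ_{p,k} N_{kpi} N_{pkj}`. -/
def N2m (N : V6 →ₗ[ℝ] V6 →ₗ[ℝ] V6 →ₗ[ℝ] ℝ) (i j : Fin 6) : ℝ :=
  ∑ p : Fin 6, ∑ k : Fin 6, Nc N k p i * Nc N p k j

/-- `|N|² = Σ_{i,p,k} N_{ipk}²`. -/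
def normNsq (N : V6 →ₗ[ℝ] V6 →ₗ[ℝ] V6 →ₗ[ℝ] ℝ) : ℝ :=
  ∑ i : Fin 6, ∑ p : Fin 6, ∑ k : Fin 6, (Nc N i p k) ^ 2

/-- A contraction of two three-index arrays, evaluated on a vector as a quadratic form. -/
lemma sum_sum_contraction {ι R : Type*} [Fintype ι] [CommSemiring R] (G H : ι → ι → ι → R)
    (x : ι → R) :
    ∑ i, ∑ j, (∑ p, ∑ k, G p k i * H p k j) * x i * x j =
      ∑ p, ∑ k, (∑ i, G p k i * x i) * ∑ j, H p k j * x j := by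
  have h (i j : ι) : (∑ p, ∑ k, G p k i * H p k j) * x i * x j =
      ∑ q : ι × ι, G q.1 q.2 i * x i * (H q.1 q.2 j * x j) := by
    rw [← Fintype.sum_prod_type', Finset.sum_mul, Finset.sum_mul]
    exact Finset.sum_congr rfl fun q _ => by ring
  rw [← Fintype.sum_prod_type' fun p k => (∑ i, G p k i * x i) * ∑ j, H p k j * x j]
  simp only [h, Finset.sum_mul_sum]
  rw [Finset.sum_comm_cycle]

/-- The trace of the square of a real matrix is at most its squared Frobenius norm. -/
lemma sum_mul_swap_le_sum_sq {ι : Type*} [Fintype ι] (A : ι → ι → ℝ) :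
    ∑ p, ∑ k, A k p * A p k ≤ ∑ p, ∑ k, A p k ^ 2 := by
  have hswap : ∑ p, ∑ k, A k p ^ 2 = ∑ p, ∑ k, A p k ^ 2 := Finset.sum_comm
  have h : 2 * ∑ p, ∑ k, A k p * A p k ≤ ∑ p, ∑ k, A k p ^ 2 + ∑ p, ∑ k, A p k ^ 2 := by
    simp only [Finset.mul_sum, ← Finset.sum_add_distrib, ← mul_assoc]
    gcongr
    exact two_mul_le_add_sq _ _
  linarith

/-- The index of the basis vector proportional to `Jstd (e6 i)`. -/
def rotIndex : Fin 6 → Fin 6 := ![1, 0, 3, 2, 5, 4]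

/-- The sign with which `Jstd` sends `e6 i` to `e6 (rotIndex i)`. -/
def rotSign : Fin 6 → ℝ := ![1, -1, 1, -1, 1, -1]

lemma Jstd_e6 (i : Fin 6) : Jstd (e6 i) = rotSign i • e6 (rotIndex i) := by
  ext k
  fin_cases i <;> fin_cases k <;> simp [Jstd, e6, rotSign, rotIndex]

/-- The component form of the conditions for a trilinear map to be a `φ₀`-compatible
Nijenhuis-type tensor. The compatibility condition says that the traceless complex matrix
determined by the tensor is anti-Hermitian. -/
structure IsCompatibleNijenhuis (F : Fin 6 → Fin 6 → Fin 6 → ℝ) : Prop where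
  anti : ∀ i j k, F i j k = -F i k j
  type_fst : ∀ i j k, rotSign i * F (rotIndex i) j k = rotSign j * F i (rotIndex j) k
  bianchi : ∀ i j k, F i j k + F k i j + F j k i = 0
  re_diag₀ : F 0 2 4 = 0
  re_diag₁ : F 2 0 4 = 0
  re_diag₂ : F 4 0 2 = 0
  re_offDiag₁₀ : F 2 2 4 = F 0 0 4
  im_offDiag₁₀ : F 2 3 4 = -F 1 0 4
  re_offDiag₂₀ : F 4 2 4 = -F 0 0 2
  im_offDiag₂₀ : F 4 3 4 = F 1 0 2
  re_offDiag₂₁ : F 4 0 4 = F 2 0 2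
  im_offDiag₂₁ : F 4 1 4 = -F 3 0 2

lemma isCompatibleNijenhuis_Nc (N : V6 →ₗ[ℝ] V6 →ₗ[ℝ] V6 →ₗ[ℝ] ℝ)
    (hanti : ∀ x y z : V6, N x y z = -N x z y)
    (htype1 : ∀ x y z : V6, N (Jstd x) y z = N x (Jstd y) z)
    (hbianchi : ∀ x y z : V6, N x y z + N z x y + N y z x = 0)
    (hcompat : ∀ x y z w : V6,
      (∑ p : Fin 6, (N (e6 p) x y * phi0 (e6 p) z w + N (e6 p) z w * phi0 (e6 p) x y)) = 0) :
    IsCompatibleNijenhuis (Nc N) := by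
  have hanti' (i j k : Fin 6) : Nc N i j k = -Nc N i k j := hanti _ _ _
  have hcompat' (i j k l : Fin 6) : ∑ p : Fin 6, (Nc N p i j * phi0 (e6 p) (e6 k) (e6 l) +
      Nc N p k l * phi0 (e6 p) (e6 i) (e6 j)) = 0 := hcompat _ _ _ _
  simp only [phi0, elem3, Matrix.det_fin_three, Fin.sum_univ_six] at hcompat'
  refine ⟨hanti', fun i j k => ?_, fun i j k => hbianchi _ _ _,
    ?_, ?_, ?_, ?_, ?_, ?_, ?_, ?_, ?_⟩
  · simpa [Jstd_e6, Nc] using htype1 (e6 i) (e6 j) (e6 k)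
  · have h := hcompat' 2 4 2 4
    simp [e6] at h
    linarith
  · have h := hcompat' 0 4 0 4
    simp [e6] at h
    linarith
  · have h := hcompat' 0 2 0 2
    simp [e6] at h
    linarith
  · have h := hcompat' 2 4 0 4
    simp [e6] at h
    linarith
  · have h := hcompat' 3 4 0 4
    simp [e6] at h
    linarith
  · have h := hcompat' 2 4 0 2
    simp [e6] at h
    linarith
  · have h := hcompat' 3 4 0 2
    simp [e6] at h
    linarith
  · have h := hcompat' 0 4 0 2
    simp [e6] at h
    linarith
  · have h := hcompat' 1 4 0 2
    simp [e6] at h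
    linarith

namespace IsCompatibleNijenhuis

variable {F : Fin 6 → Fin 6 → Fin 6 → ℝ}

lemma apply_self (hF : IsCompatibleNijenhuis F) (i j : Fin 6) : F i j j = 0 := by
  linarith [hF.anti i j j]

set_option maxHeartbeats 4000000 in
/-- The quadratic identity for the components of a compatible Nijenhuis-type tensor, obtained by
writing all of them in terms of the entries of an anti-Hermitian traceless matrix. -/
lemma sum_mul_swap (hF : IsCompatibleNijenhuis F) (i j : Fin 6) :
    ∑ p : Fin 6, ∑ k : Fin 6, F k p i * F p k j =
      2 * (∑ p : Fin 6, ∑ k : Fin 6, F p k i * F p k j) -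
        (1 / 4 : ℝ) * (∑ i : Fin 6, ∑ p : Fin 6, ∑ k : Fin 6, (F i p k) ^ 2) *
          (if i = j then 1 else 0) := by
  have move (i k : Fin 6) : F i 1 k = rotSign i * F (rotIndex i) 0 k ∧
      F i 3 k = rotSign i * F (rotIndex i) 2 k ∧ F i 5 k = rotSign i * F (rotIndex i) 4 k := by
    refine ⟨?_, ?_, ?_⟩
    · simpa [rotSign, rotIndex] using (hF.type_fst i 0 k).symm
    · simpa [rotSign, rotIndex] using (hF.type_fst i 2 k).symm
    · simpa [rotSign, rotIndex] using (hF.type_fst i 4 k).symm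
  have move' (i j : Fin 6) : F i j 1 = rotSign i * F (rotIndex i) j 0 ∧
      F i j 3 = rotSign i * F (rotIndex i) j 2 ∧ F i j 5 = rotSign i * F (rotIndex i) j 4 := by
    simp only [hF.anti _ j, move, mul_neg, and_self]
  have h1 (i k : Fin 6) := (move i k).1
  have h3 (i k : Fin 6) := (move i k).2.1
  have h5 (i k : Fin 6) := (move i k).2.2
  have h1' (i k : Fin 6) := (move' i k).1
  have h3' (i k : Fin 6) := (move' i k).2.1
  have h5' (i k : Fin 6) := (move' i k).2.2
  have s20 (i : Fin 6) := hF.anti i 2 0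
  have s40 (i : Fin 6) := hF.anti i 4 0
  have s42 (i : Fin 6) := hF.anti i 4 2
  have im₁₀ : F 3 2 4 = -F 1 0 4 := by
    simpa [h3, rotSign, rotIndex] using hF.im_offDiag₁₀
  have im₂₀ : F 5 2 4 = F 1 0 2 := by
    simpa [h3, rotSign, rotIndex] using hF.im_offDiag₂₀
  have im₂₁ : F 5 0 4 = -F 3 0 2 := by
    simpa [h1, rotSign, rotIndex] using hF.im_offDiag₂₁
  have trace : F 5 0 2 = F 3 0 4 - F 1 2 4 := by
    have h := hF.bianchi 1 2 4
    simp [h1, h1', s40, rotSign, rotIndex] at h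
    linarith
  have norm : ∑ i : Fin 6, ∑ p : Fin 6, ∑ k : Fin 6, (F i p k) ^ 2 =
      16 * ((F 1 2 4) ^ 2 + (F 3 0 4) ^ 2 - F 1 2 4 * F 3 0 4 + (F 0 0 4) ^ 2 + (F 1 0 4) ^ 2 +
        (F 0 0 2) ^ 2 + (F 1 0 2) ^ 2 + (F 2 0 2) ^ 2 + (F 3 0 2) ^ 2) := by
    simp only [Fin.sum_univ_six, h1, h3, h5, h1', h3', h5', s20, s40, s42,
      hF.apply_self, rotSign, rotIndex,
      hF.re_diag₀, hF.re_diag₁, hF.re_diag₂, hF.re_offDiag₁₀, im₁₀,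
      hF.re_offDiag₂₀, im₂₀, hF.re_offDiag₂₁, im₂₁, trace, Matrix.cons_val, one_mul,
      neg_mul, mul_neg, neg_neg, neg_zero, mul_zero]
    ring
  rw [norm]
  simp only [Fin.sum_univ_six]
  fin_cases i <;> fin_cases j <;>
  · simp only [Fin.zero_eta, Fin.mk_one, Fin.reduceFinMk, Fin.reduceEq, if_true, if_false,
      h1, h3, h5, h1', h3', h5', s20, s40, s42,
      hF.apply_self, rotSign, rotIndex,
      hF.re_diag₀, hF.re_diag₁, hF.re_diag₂, hF.re_offDiag₁₀, im₁₀,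
      hF.re_offDiag₂₀, im₂₀, hF.re_offDiag₂₁, im₂₁, trace, Matrix.cons_val, one_mul,
      neg_mul, mul_neg, neg_neg, neg_zero, mul_zero]
    ring

end IsCompatibleNijenhuis

/-- Quadratic identity for the Nijenhuis tensor in Type IIA geometry:
for a φ₀-compatible Nijenhuis-type tensor `N`, `(N²₋)_{ij} = 2(N²₊)_{ij} − (1/4)|N|² δ_{ij}`;
in particular `0 ≤ N²₊ ≤ (1/4)|N|²·Id` as quadratic forms. -/
theorem nijenhuis_quadratic_identity (N : V6 →ₗ[ℝ] V6 →ₗ[ℝ] V6 →ₗ[ℝ] ℝ)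
    (hanti : ∀ x y z : V6, N x y z = -N x z y)
    (htype1 : ∀ x y z : V6, N (Jstd x) y z = N x (Jstd y) z)
    (htype2 : ∀ x y z : V6, N x (Jstd y) z = N x y (Jstd z))
    (hbianchi : ∀ x y z : V6, N x y z + N z x y + N y z x = 0)
    (hcompat : ∀ x y z w : V6,
      (∑ p : Fin 6, (N (e6 p) x y * phi0 (e6 p) z w + N (e6 p) z w * phi0 (e6 p) x y)) = 0) :
    (∀ i j : Fin 6,
      N2m N i j = 2 * N2p N i j - (1 / 4 : ℝ) * normNsq N * (if i = j then 1 else 0)) ∧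
    (∀ x : V6, 0 ≤ ∑ i : Fin 6, ∑ j : Fin 6, N2p N i j * x i * x j) ∧
    (∀ x : V6, (∑ i : Fin 6, ∑ j : Fin 6, N2p N i j * x i * x j)
        ≤ (1 / 4 : ℝ) * normNsq N * ∑ i : Fin 6, (x i) ^ 2) := by
  have hF := isCompatibleNijenhuis_Nc N hanti htype1 hbianchi hcompat
  have hN (i j : Fin 6) :
      N2m N i j = 2 * N2p N i j - (1 / 4 : ℝ) * normNsq N * (if i = j then 1 else 0) :=
    hF.sum_mul_swap i j
  have hp (x : V6) : ∑ i : Fin 6, ∑ j : Fin 6, N2p N i j * x i * x j =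
      ∑ p : Fin 6, ∑ k : Fin 6, (∑ i : Fin 6, Nc N p k i * x i) ^ 2 := by
    simp only [N2p, sq]
    exact sum_sum_contraction (Nc N) (Nc N) x
  refine ⟨hN, fun x => ?_, fun x => ?_⟩
  · rw [hp]
    positivity
  · have hm : ∑ i : Fin 6, ∑ j : Fin 6, N2m N i j * x i * x j = _ :=
      sum_sum_contraction (fun p k i => Nc N k p i) (Nc N) x
    have hle := sum_mul_swap_le_sum_sq (fun p k : Fin 6 => ∑ i : Fin 6, Nc N p k i * x i)
    rw [← hm, ← hp] at hle
    have hd : ∑ i : Fin 6, ∑ j : Fin 6, N2m N i j * x i * x j =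
        2 * (∑ i : Fin 6, ∑ j : Fin 6, N2p N i j * x i * x j) -
          (1 / 4 : ℝ) * normNsq N * ∑ i : Fin 6, (x i) ^ 2 := by
      simp only [hN, sub_mul, Finset.sum_sub_distrib, Finset.mul_sum, mul_assoc, ite_mul, mul_ite,
        one_mul, zero_mul, mul_zero, Finset.sum_ite_eq, Finset.mem_univ, if_true, sq]
    linarith
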